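/- arXiv:1801.03459 — 3 statements merged into one kernel-verified Lean document; each statement's English description precedes it below -/
import Mathlib

section
/- (Lemma 1.) Let g be a strategy profile and a_{1:T} ∈ 𝒜^T an action sequence. For each t, define the history probability P^g(a_{1:t-1}) := ∑_{x∈𝒳} Q(x)·∏_{n=1}^{t-1} ∏_i g^i_n(a^i_n|a_{1:n-1},x^i), and, whenever P^g(a_{1:t-1}) > 0, define the posterior belief π_t[a_{1:t-1}](x) := Q(x)·∏_{n=1}^{t-1} ∏_i g^i_n(a^i_n|a_{1:n-1},x^i) / P^g(a_{1:t-1}). Then for every t ∈ {1,…,T} with P^g(a_{1:t}) > 0 one has π_{t+1}[a_{1:t}] = F(π_t[a_{1:t-1}], γ_t, a_t), where γ_t is the prescription profile with γ^i_t(a^i|x^i) := g^i_t(a^i|a_{1:t-1},x^i); in particular, the update map F does not depend on the strategy profile g. -/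
open Finset

/-! ## Common setup

`N` players with private types `X i` and actions `A i`, all nonempty and finite.
A history is a `List (∀ i, A i)` of past joint actions in chronological order;
the kernel used at time `n` is the one applied to histories of length `n - 1`. -/

noncomputable section

variable {N : ℕ} {X A : Fin N → Type*}

/-- Combine player `i`'s private type `xi` with the profile `xm` of the other
players' private types into a full type profile `x = (x^i, x^{-i})`. -/
def combine (i : Fin N) (xi : X i) (xm : ∀ j : {j : Fin N // j ≠ i}, X j.1)
    (j : Fin N) : X j :=
  if h : j = i then h.symm ▸ xi else xm ⟨j, h⟩

section

variable [∀ i, Fintype (X i)] [∀ i, Fintype (A i)]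

/-- `π` is a belief on the product type: nonnegative and summing to one. -/
def IsBelief (π : (∀ i, X i) → ℝ) : Prop :=
  (∀ x, 0 ≤ π x) ∧ ∑ x, π x = 1

/-- `γ` is a prescription profile: each `γ i (x^i)` is a probability vector on `A i`. -/
def IsPresc (γ : ∀ i, X i → A i → ℝ) : Prop :=
  ∀ i xi, (∀ ai, 0 ≤ γ i xi ai) ∧ ∑ ai, γ i xi ai = 1

/-- `σi` is a behavioral strategy kernel of player `i`: for each history and
private type, a probability vector on `A i`. -/
def IsKernel (i : Fin N) (σi : List (∀ j, A j) → X i → A i → ℝ) : Prop :=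
  ∀ h xi, (∀ ai, 0 ≤ σi h xi ai) ∧ ∑ ai, σi h xi ai = 1

/-- Likelihood `L(π,γ,a) = ∑_x π(x) ∏_i γ^i(a^i|x^i)`. -/
def like (π : (∀ i, X i) → ℝ) (γ : ∀ i, X i → A i → ℝ) (a : ∀ i, A i) : ℝ :=
  ∑ x, π x * ∏ i, γ i (x i) (a i)

/-- Belief update `F(π,γ,a)`: Bayes' rule when the likelihood is positive,
and `π` itself otherwise. -/
def bUpdate (π : (∀ i, X i) → ℝ) (γ : ∀ i, X i → A i → ℝ) (a : ∀ i, A i) :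
    (∀ i, X i) → ℝ :=
  if 0 < like π γ a then fun x => π x * (∏ i, γ i (x i) (a i)) / like π γ a else π

/-- Marginal probability `π(x^i)` of player `i`'s type `xi` under belief `π`. -/
def marginal (π : (∀ i, X i) → ℝ) (i : Fin N) (xi : X i) : ℝ :=
  ∑ xm : ∀ j : {j : Fin N // j ≠ i}, X j.1, π (combine i xi xm)

end

end
section

variable {N : ℕ} {X A : Fin N → Type*}
variable [∀ i, Fintype (X i)] [∀ i, Fintype (A i)]

/-- Forward recursion of the common belief: `piStar θ t π h` is the belief obtained
from belief `π` at time `t` after observing the joint-action history `h`, using the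
equilibrium generating function `θ`.  Thus `piStar θ 1 Q h = π*_{|h|+1}[h]`. -/
noncomputable def piStar (θ : ℕ → ((∀ i, X i) → ℝ) → ∀ i, X i → A i → ℝ) :
    ℕ → ((∀ i, X i) → ℝ) → List (∀ i, A i) → (∀ i, X i) → ℝ
  | _, π, [] => π
  | t, π, a :: h => piStar θ (t + 1) (bUpdate π (θ t π) a) h

/-- Equilibrium strategy `β*` from the forward recursion:
`β*^j_t(a^j|a_{1:t-1},x^j) = θ_t[π*_t[a_{1:t-1}]]^j(a^j|x^j)` where `t - 1` is the
length of the history. -/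
noncomputable def betaStar (θ : ℕ → ((∀ i, X i) → ℝ) → ∀ i, X i → A i → ℝ)
    (Q : (∀ i, X i) → ℝ) (j : Fin N) (h : List (∀ i, A i)) (xj : X j) (aj : A j) : ℝ :=
  θ (h.length + 1) (piStar θ 1 Q h) j xj aj

/-- The strategy profile in which player `i` uses `βi` and every other player `j`
uses `σ j`. -/
def unilateral (i : Fin N) (βi : List (∀ j, A j) → X i → A i → ℝ)
    (σ : ∀ j, List (∀ k, A k) → X j → A j → ℝ) (j : Fin N) :
    List (∀ k, A k) → X j → A j → ℝ :=
  if h : j = i then (fun hist xj aj => βi hist (h ▸ xj) (h ▸ aj)) else σ j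

/-- Probability weight of a future joint-action path `f` of length `m` following the
history `h`, given the state `x`, under the strategy profile `σ`:
`∏_k ∏_j σ^j(f_k^j | h f_{0:k-1}, x^j)`. -/
def pathWeight (σ : ∀ j, List (∀ k, A k) → X j → A j → ℝ)
    (h : List (∀ k, A k)) (x : ∀ j, X j) {m : ℕ} (f : Fin m → ∀ k, A k) : ℝ :=
  ∏ k : Fin m, ∏ j, σ j (h ++ (List.ofFn f).take (k : ℕ)) (x j) (f k j)

/-- Total reward of player `i` along the action path `f`, starting at time `s`:
`∑_{n=s}^{s+m-1} R^i_n(x, a_n)`. -/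
def rewardSum (R : Fin N → ℕ → (∀ j, X j) → (∀ j, A j) → ℝ)
    (i : Fin N) (s : ℕ) (x : ∀ j, X j) {m : ℕ} (f : Fin m → ∀ j, A j) : ℝ :=
  ∑ k : Fin m, R i (s + (k : ℕ)) x (f k)

/-- The conditional measure on `(x^{-i}, future actions)` given `(h, x^i)`:
root belief `π(x^{-i}|x^i)` times the path weight under `σ`. -/
noncomputable def muMeas (π : (∀ j, X j) → ℝ)
    (σ : ∀ j, List (∀ k, A k) → X j → A j → ℝ)
    (h : List (∀ k, A k)) (i : Fin N) (xi : X i)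
    (xm : ∀ j : {j : Fin N // j ≠ i}, X j.1) {m : ℕ} (f : Fin m → ∀ k, A k) : ℝ :=
  (π (combine i xi xm) / marginal π i xi) * pathWeight σ h (combine i xi xm) f

/-- Conditional expected reward-to-go of player `i` from time `s` over `m` stages,
given history `h` and own type `xi`, with root belief `π` and strategy profile `σ`:
`E^{σ,π}[∑_{n=s}^{s+m-1} R^i_n | h, x^i]`. -/
noncomputable def condExp (R : Fin N → ℕ → (∀ j, X j) → (∀ j, A j) → ℝ)
    (i : Fin N) (s m : ℕ) (π : (∀ j, X j) → ℝ)
    (σ : ∀ j, List (∀ k, A k) → X j → A j → ℝ)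
    (h : List (∀ k, A k)) (xi : X i) : ℝ :=
  ∑ xm : ∀ j : {j : Fin N // j ≠ i}, X j.1, ∑ f : Fin m → ∀ k, A k,
    muMeas π σ h i xi xm f * rewardSum R i s (combine i xi xm) f

/-- Stage objective `W(γ^i)` of the backward recursion at time `t`, belief `π`,
player `i` with type `xi`, when player `i` uses the probability vector `p` on `A i`
and the others use the prescriptions `γt`. -/
noncomputable def stageW (R : Fin N → ℕ → (∀ j, X j) → (∀ j, A j) → ℝ)
    (V : ∀ i : Fin N, ℕ → ((∀ j, X j) → ℝ) → X i → ℝ) (t : ℕ)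
    (π : (∀ j, X j) → ℝ) (γt : ∀ j, X j → A j → ℝ) (i : Fin N) (xi : X i)
    (p : A i → ℝ) : ℝ :=
  ∑ xm : ∀ j : {j : Fin N // j ≠ i}, X j.1, ∑ a : ∀ j, A j,
    (π (combine i xi xm) / marginal π i xi) * p (a i) *
      (∏ j ∈ Finset.univ.erase i, γt j (combine i xi xm j) (a j)) *
      (R i t (combine i xi xm) a + V i (t + 1) (bUpdate π γt a) xi)

/-- The backward-recursion conditions on the value functions `V` and equilibrium
generating function `θ`: `V^i_{T+1} ≡ 0`, and at every time `t ∈ {1,…,T}`, belief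
`π`, player `i` and type `xi` of positive marginal, the prescription `θ t π i xi`
maximizes the stage objective among probability vectors on `A i`, and `V^i_t(π,x^i)`
is the corresponding maximum value. -/
noncomputable def BackwardOK (T : ℕ)
    (R : Fin N → ℕ → (∀ j, X j) → (∀ j, A j) → ℝ)
    (V : ∀ i : Fin N, ℕ → ((∀ j, X j) → ℝ) → X i → ℝ)
    (θ : ℕ → ((∀ j, X j) → ℝ) → ∀ j, X j → A j → ℝ) : Prop :=
  (∀ i π xi, V i (T + 1) π xi = 0) ∧
  ∀ t, 1 ≤ t → t ≤ T → ∀ π : (∀ j, X j) → ℝ, IsBelief π →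
    ∀ i xi, 0 < marginal π i xi →
      (∀ p : A i → ℝ, (∀ ai, 0 ≤ p ai) → (∑ ai, p ai) = 1 →
        stageW R V t π (θ t π) i xi p ≤ stageW R V t π (θ t π) i xi (θ t π i xi)) ∧
      V i t π xi = stageW R V t π (θ t π) i xi (θ t π i xi)

end

/-- The history probability `P^g(a_{1:n})`: the probability, under prior `Q` and
strategy profile `g`, of observing the first `n` joint actions of the sequence `a`
(where `a k` is the joint action taken at time `k + 1`). -/
noncomputable def histProb {N : ℕ} {X A : Fin N → Type*} [∀ i, Fintype (X i)]
    (Q : (∀ i, X i) → ℝ) (g : ∀ i, List (∀ j, A j) → X i → A i → ℝ)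
    (a : ℕ → ∀ i, A i) (n : ℕ) : ℝ :=
  ∑ x, Q x * ∏ k ∈ Finset.range n, ∏ i,
    g i (List.ofFn fun m : Fin k => a m) (x i) (a k i)

/-- The posterior belief `π_{n+1}[a_{1:n}]` on `𝒳` after the first `n` joint
actions, defined by Bayes' rule from the prior `Q` and the strategy profile `g`. -/
noncomputable def post {N : ℕ} {X A : Fin N → Type*} [∀ i, Fintype (X i)]
    (Q : (∀ i, X i) → ℝ) (g : ∀ i, List (∀ j, A j) → X i → A i → ℝ)
    (a : ℕ → ∀ i, A i) (n : ℕ) (x : ∀ i, X i) : ℝ :=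
  Q x * (∏ k ∈ Finset.range n, ∏ i,
      g i (List.ofFn fun m : Fin k => a m) (x i) (a k i)) / histProb Q g a n

theorem histProb_succ {N : ℕ} {X A : Fin N → Type*} [∀ i, Fintype (X i)]
    (Q : (∀ i, X i) → ℝ) (g : ∀ i, List (∀ j, A j) → X i → A i → ℝ)
    (a : ℕ → ∀ i, A i) (n : ℕ) :
    histProb Q g a (n + 1) =
      ∑ x, Q x * (∏ k ∈ Finset.range n, ∏ i,
        g i (List.ofFn fun m : Fin k => a m) (x i) (a k i)) *
          ∏ i, g i (List.ofFn fun m : Fin n => a m) (x i) (a n i) := by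
  simp only [histProb, Finset.prod_range_succ, mul_assoc]

theorem like_post {N : ℕ} {X A : Fin N → Type*} [∀ i, Fintype (X i)]
    (Q : (∀ i, X i) → ℝ) (g : ∀ i, List (∀ j, A j) → X i → A i → ℝ)
    (a : ℕ → ∀ i, A i) (n : ℕ) :
    like (post Q g a n) (fun i => g i (List.ofFn fun m : Fin n => a m)) (a n) =
      histProb Q g a (n + 1) / histProb Q g a n := by
  rw [histProb_succ, like, Finset.sum_div]
  exact Finset.sum_congr rfl fun x _ => div_mul_eq_mul_div _ _ _

/-- A history of positive probability has prefixes of positive probability. -/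
theorem histProb_pos_of_succ {N : ℕ} {X A : Fin N → Type*}
    [∀ i, Fintype (X i)] [∀ i, Fintype (A i)]
    {Q : (∀ i, X i) → ℝ} (hQ : ∀ x, 0 ≤ Q x)
    {g : ∀ i, List (∀ j, A j) → X i → A i → ℝ} (hg : ∀ i, IsKernel i (g i))
    {a : ℕ → ∀ i, A i} {n : ℕ} (hpos : 0 < histProb Q g a (n + 1)) :
    0 < histProb Q g a n := by
  have hw : ∀ x ∈ Finset.univ, 0 ≤ Q x * ∏ k ∈ Finset.range n, ∏ i,
      g i (List.ofFn fun m : Fin k => a m) (x i) (a k i) := fun x _ =>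
    mul_nonneg (hQ x) <| Finset.prod_nonneg fun _ _ => Finset.prod_nonneg fun i _ =>
      (hg i _ _).1 _
  refine (Finset.sum_nonneg hw).lt_of_ne fun h0 => hpos.ne' ?_
  rw [histProb_succ]
  refine Finset.sum_eq_zero fun x hx => ?_
  rw [(Finset.sum_eq_zero_iff_of_nonneg hw).1 h0.symm x hx, zero_mul]

/-- **Lemma 1.** For every strategy profile `g`, action sequence `a`
and time `t ∈ {1,…,T}` with `P^g(a_{1:t}) > 0`, the posterior satisfies
`π_{t+1}[a_{1:t}] = F(π_t[a_{1:t-1}], γ_t, a_t)`, where `γ_t` is the prescription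
profile `γ^i_t(a^i|x^i) = g^i_t(a^i|a_{1:t-1},x^i)`; in particular the update map
`F` does not depend on `g`. -/
theorem posterior_update {N T : ℕ} {X A : Fin N → Type*}
    [∀ i, Fintype (X i)] [∀ i, Nonempty (X i)]
    [∀ i, Fintype (A i)] [∀ i, Nonempty (A i)]
    (hT : 1 ≤ T)
    (Q : (∀ i, X i) → ℝ) (hQ : IsBelief Q)
    (g : ∀ i, List (∀ j, A j) → X i → A i → ℝ) (hg : ∀ i, IsKernel i (g i))
    (a : ℕ → ∀ i, A i)
    (t : ℕ) (h1 : 1 ≤ t) (h2 : t ≤ T)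
    (hpos : 0 < histProb Q g a t) :
    post Q g a t =
      bUpdate (post Q g a (t - 1))
        (fun i => g i (List.ofFn fun m : Fin (t - 1) => a m)) (a (t - 1)) := by
  obtain ⟨n, rfl⟩ := Nat.exists_eq_add_of_le' h1
  change post Q g a (n + 1) = bUpdate (post Q g a n)
    (fun i => g i (List.ofFn fun m : Fin n => a m)) (a n)
  have hn := histProb_pos_of_succ hQ.1 hg hpos
  have hL := like_post Q g a n
  rw [bUpdate, if_pos (hL ▸ div_pos hpos hn), hL]
  funext x
  simp only [post, Finset.prod_range_succ]
  field_simp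
end

section
/- Let π be a belief on 𝒳, γ a prescription profile, i a player, x^i ∈ 𝒳^i and a ∈ 𝒜. Assume L(π,γ,a) > 0, γ^i(a^i|x^i) > 0, and D := ∑_{x^{-i}} π(x^{-i},x^i)·∏_{j≠i} γ^j(a^j|x^j) > 0. Then the marginal ∑_{x'^{-i}} F(π,γ,a)(x'^{-i},x^i) is positive and, for every x^{-i}, F(π,γ,a)(x^{-i},x^i) / ∑_{x'^{-i}} F(π,γ,a)(x'^{-i},x^i) = π(x^{-i},x^i)·∏_{j≠i} γ^j(a^j|x^j) / D. In particular, the conditional of the updated common belief on x^{-i} given player i's own type x^i does not depend on player i's own prescription γ^i. -/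
open Finset

theorem combine_self {N : ℕ} {X : Fin N → Type*} (i : Fin N) (xi : X i)
    (xm : ∀ j : {j : Fin N // j ≠ i}, X j.1) : combine i xi xm i = xi := by
  simp [combine]

/-- On profiles containing `xi`, the belief update is the weight formed from the other
players' prescriptions, scaled by a factor depending only on player `i`'s type. -/
theorem bUpdate_combine {N : ℕ} {X A : Fin N → Type*}
    [∀ i, Fintype (X i)]
    {π : (∀ i, X i) → ℝ} {γ : ∀ i, X i → A i → ℝ} {a : ∀ j, A j}
    (hL : 0 < like π γ a) (i : Fin N) (xi : X i)
    (xm : ∀ j : {j : Fin N // j ≠ i}, X j.1) :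
    bUpdate π γ a (combine i xi xm) =
      γ i xi (a i) / like π γ a *
        (π (combine i xi xm) *
          ∏ j ∈ Finset.univ.erase i, γ j (combine i xi xm j) (a j)) := by
  rw [bUpdate, if_pos hL]
  rw [← Finset.mul_prod_erase Finset.univ _ (Finset.mem_univ i), combine_self]
  ring

/-- Let `π` be a belief, `γ` a prescription profile, `i` a player,
`x^i ∈ 𝒳^i` and `a ∈ 𝒜`.  If `L(π,γ,a) > 0`, `γ^i(a^i|x^i) > 0` and
`D = ∑_{x^{-i}} π(x^{-i},x^i)·∏_{j≠i} γ^j(a^j|x^j) > 0`, then the marginal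
`∑_{x'^{-i}} F(π,γ,a)(x'^{-i},x^i)` is positive and, for every `x^{-i}`,
`F(π,γ,a)(x^{-i},x^i) / ∑_{x'^{-i}} F(π,γ,a)(x'^{-i},x^i)
  = π(x^{-i},x^i)·∏_{j≠i} γ^j(a^j|x^j) / D`.
In particular the conditional of the updated common belief on `x^{-i}` given `x^i`
does not depend on player `i`'s own prescription `γ^i`. -/
theorem conditional_update_independent {N : ℕ} {X A : Fin N → Type*}
    [∀ i, Fintype (X i)] [∀ i, Nonempty (X i)]
    [∀ i, Fintype (A i)] [∀ i, Nonempty (A i)]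
    (π : (∀ i, X i) → ℝ) (hπ : IsBelief π)
    (γ : ∀ i, X i → A i → ℝ) (hγ : IsPresc γ)
    (i : Fin N) (xi : X i) (a : ∀ j, A j)
    (hL : 0 < like π γ a)
    (hγi : 0 < γ i xi (a i))
    (hD : 0 < ∑ xm : ∀ j : {j : Fin N // j ≠ i}, X j.1,
        π (combine i xi xm) *
          ∏ j ∈ Finset.univ.erase i, γ j (combine i xi xm j) (a j)) :
    (0 < ∑ xm' : ∀ j : {j : Fin N // j ≠ i}, X j.1,
        bUpdate π γ a (combine i xi xm')) ∧
    ∀ xm : ∀ j : {j : Fin N // j ≠ i}, X j.1,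
      bUpdate π γ a (combine i xi xm) /
          (∑ xm' : ∀ j : {j : Fin N // j ≠ i}, X j.1,
            bUpdate π γ a (combine i xi xm')) =
        π (combine i xi xm) *
            (∏ j ∈ Finset.univ.erase i, γ j (combine i xi xm j) (a j)) /
          (∑ xm' : ∀ j : {j : Fin N // j ≠ i}, X j.1,
            π (combine i xi xm') *
              ∏ j ∈ Finset.univ.erase i, γ j (combine i xi xm' j) (a j)) := by
  have hc : 0 < γ i xi (a i) / like π γ a := div_pos hγi hL
  simp only [bUpdate_combine hL, ← Finset.mul_sum]
  exact ⟨mul_pos hc hD, fun xm => mul_div_mul_left _ _ hc.ne'⟩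
end

section
/- (Lemma 3.) Fix a player i, a time t ∈ {1,…,T-1}, a history a_{1:t} ∈ 𝒜^t and a type x^i. Let β^i = (β^i_n)_{n=t}^T be any strategy of player i and let the other players use β^{*,-i}. Write π := π*_t[a_{1:t-1}], π' := π*_{t+1}[a_{1:t}], γ̃ := θ_t[π*_t[a_{1:t-1}]], and assume π(x^i) > 0, L(π,γ̃,a_t) > 0, γ̃^i(a^i_t|x^i) > 0, β^i_t(a^i_t|a_{1:t-1},x^i) > 0 and ∑_{x^{-i}} π(x^{-i},x^i)·∏_{j≠i} γ̃^j(a^j_t|x^j) > 0. Then the conditional expected future reward of player i given (a_{1:t}, x^i) computed under the strategies (β^i_{t:T}, β^{*,-i}_{t:T}) with root belief π(·|x^i) (i.e. the sum over (x^{-i}, a_{t+1:T}) of ∑_{n=t+1}^T R^i_n(x, a_n) weighted by the measure μ(x^{-i},a_{t:T}) := (π(x^{-i},x^i)/π(x^i))·∏_{n=t}^T [β^i_n(a^i_n|a_{1:n-1},x^i)·∏_{j≠i} β^{*,j}_n(a^j_n|a_{1:n-1},x^j)] normalized by conditioning on the realized a_t) equals E^{β^i_{t+1:T} β^{*,-i}_{t+1:T},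 π'}[∑_{n=t+1}^T R^i_n | a_{1:t}, x^i] := ∑_{x^{-i}} ∑_{a_{t+1:T}} (π'(x^{-i},x^i)/π'(x^i))·∏_{n=t+1}^T [β^i_n(a^i_n|a_{1:n-1},x^i)·∏_{j≠i} β^{*,j}_n(a^j_n|a_{1:n-1},x^j)]·∑_{n=t+1}^T R^i_n(x, a_n). -/
open Finset

theorem piStar_append_singleton {N : ℕ} {X A : Fin N → Type*}
    [∀ i, Fintype (X i)] [∀ i, Fintype (A i)]
    (θ : ℕ → ((∀ i, X i) → ℝ) → ∀ i, X i → A i → ℝ)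
    (h : List (∀ i, A i)) (a : ∀ i, A i) (t : ℕ) (π : (∀ i, X i) → ℝ) :
    piStar θ t π (h ++ [a]) =
      bUpdate (piStar θ t π h) (θ (t + h.length) (piStar θ t π h)) a := by
  induction h generalizing t π with
  | nil => simp [piStar]
  | cons b h ih =>
    simp only [List.cons_append, piStar, List.length_cons]
    rw [ih, show t + 1 + h.length = t + (h.length + 1) by ring]

theorem unilateral_self {N : ℕ} {X A : Fin N → Type*} (i : Fin N)
    (βi : List (∀ j, A j) → X i → A i → ℝ)
    (σ : ∀ j, List (∀ k, A k) → X j → A j → ℝ) : unilateral i βi σ i = βi := by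
  simp [unilateral]

theorem unilateral_of_ne {N : ℕ} {X A : Fin N → Type*} {i j : Fin N} (hj : j ≠ i)
    (βi : List (∀ j, A j) → X i → A i → ℝ)
    (σ : ∀ j, List (∀ k, A k) → X j → A j → ℝ) : unilateral i βi σ j = σ j := by
  simp [unilateral, hj]

theorem pathWeight_cons {N : ℕ} {X A : Fin N → Type*}
    (σ : ∀ j, List (∀ k, A k) → X j → A j → ℝ) (h : List (∀ k, A k)) (x : ∀ j, X j)
    (a : ∀ k, A k) {m : ℕ} (g : Fin m → ∀ k, A k) :
    pathWeight σ h x (Fin.cons a g : Fin (m + 1) → ∀ k, A k) =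
      (∏ j, σ j h (x j) (a j)) * pathWeight σ (h ++ [a]) x g := by
  simp [pathWeight, Fin.prod_univ_succ, List.ofFn_succ]

/-- Path weights of probability kernels sum to one. -/
theorem sum_pathWeight {N : ℕ} {X A : Fin N → Type*} [∀ i, Fintype (A i)]
    (σ : ∀ j, List (∀ k, A k) → X j → A j → ℝ)
    (hσ : ∀ j h xj, ∑ a, σ j h xj a = 1) (x : ∀ j, X j) (m : ℕ) (h : List (∀ k, A k)) :
    ∑ g : Fin m → ∀ k, A k, pathWeight σ h x g = 1 := by
  induction m generalizing h with
  | zero => simp [pathWeight]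
  | succ m ih =>
    rw [← (Fin.consEquiv fun _ : Fin (m + 1) => ∀ k, A k).sum_comp, Fintype.sum_prod_type]
    change ∑ a, ∑ g : Fin m → ∀ k, A k,
      pathWeight σ h x (Fin.cons a g : Fin (m + 1) → ∀ k, A k) = 1
    simp only [pathWeight_cons, ← Finset.mul_sum, ih, mul_one]
    rw [← Fintype.prod_sum fun j a => σ j h (x j) a]
    simp [hσ]

/-- **Lemma 3.** Fix a player `i`, a time `t ∈ {1,…,T-1}`, a history
`a_{1:t}` (the list `h` of length `t-1` followed by the realized action `a_t`) and
a type `x^i`.  Player `i` uses an arbitrary strategy `β^i` and the other players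
use the equilibrium strategies `β^{*,-i}`.  Under the stated positivity
assumptions, the conditional expected future reward of player `i` given
`(a_{1:t}, x^i)` computed from the root-belief measure `μ` at time `t` (conditioned
on the realized `a_t`) equals
`E^{β^i_{t+1:T} β^{*,-i}_{t+1:T}, π*_{t+1}}[∑_{n=t+1}^T R^i_n | a_{1:t}, x^i]`. -/
theorem lemma3_conditional_reward {N T : ℕ} {X A : Fin N → Type*}
    [∀ i, Fintype (X i)] [∀ i, Nonempty (X i)]
    [∀ i, Fintype (A i)] [∀ i, Nonempty (A i)]
    (R : Fin N → ℕ → (∀ j, X j) → (∀ j, A j) → ℝ)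
    (V : ∀ i : Fin N, ℕ → ((∀ j, X j) → ℝ) → X i → ℝ)
    (θ : ℕ → ((∀ j, X j) → ℝ) → ∀ j, X j → A j → ℝ)
    (Q : (∀ j, X j) → ℝ) (hQ : IsBelief Q)
    (hθ : ∀ t π, IsPresc (θ t π)) (hBO : BackwardOK T R V θ)
    (i : Fin N) (t : ℕ) (h1 : 1 ≤ t) (h2 : t + 1 ≤ T)
    (h : List (∀ j, A j)) (hlen : h.length = t - 1)
    (at_ : ∀ j, A j) (xi : X i)
    (βi : List (∀ j, A j) → X i → A i → ℝ) (hβi : IsKernel i βi)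
    (hmarg : 0 < marginal (piStar θ 1 Q h) i xi)
    (hL : 0 < like (piStar θ 1 Q h) (θ t (piStar θ 1 Q h)) at_)
    (hγ : 0 < θ t (piStar θ 1 Q h) i xi (at_ i))
    (hβ : 0 < βi h xi (at_ i))
    (hD : 0 < ∑ xm : ∀ j : {j : Fin N // j ≠ i}, X j.1,
        piStar θ 1 Q h (combine i xi xm) *
          ∏ j ∈ Finset.univ.erase i,
            θ t (piStar θ 1 Q h) j (combine i xi xm j) (at_ j)) :
    (∑ xm : ∀ j : {j : Fin N // j ≠ i}, X j.1, ∑ g : Fin (T - t) → ∀ j, A j,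
      muMeas (piStar θ 1 Q h) (unilateral i βi (betaStar θ Q)) h i xi xm
          (Fin.cons at_ g) /
        (∑ xm' : ∀ j : {j : Fin N // j ≠ i}, X j.1, ∑ g' : Fin (T - t) → ∀ j, A j,
          muMeas (piStar θ 1 Q h) (unilateral i βi (betaStar θ Q)) h i xi xm'
            (Fin.cons at_ g')) *
        rewardSum R i (t + 1) (combine i xi xm) g) =
    condExp R i (t + 1) (T - t) (piStar θ 1 Q (h ++ [at_]))
      (unilateral i βi (betaStar θ Q)) (h ++ [at_]) xi := by
  have hlen' : h.length + 1 = t := by omega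
  set π := piStar θ 1 Q h with hπ
  set σ := unilateral i βi (betaStar θ Q) with hσ
  let G : (∀ j : {j : Fin N // j ≠ i}, X j.1) → ℝ := fun xm =>
    ∏ j ∈ Finset.univ.erase i, θ t π j (combine i xi xm j) (at_ j)
  change 0 < ∑ xm, π (combine i xi xm) * G xm at hD
  have hσsum : ∀ j h xj, ∑ a, σ j h xj a = 1 := by
    intro j h xj
    by_cases hj : j = i
    · subst hj
      rw [hσ, unilateral_self]
      exact (hβi h xj).2
    · rw [hσ, unilateral_of_ne hj]
      exact (hθ _ _ j xj).2
  have hstep : ∀ xm, ∏ j, σ j h (combine i xi xm j) (at_ j) = βi h xi (at_ i) * G xm := by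
    intro xm
    rw [← Finset.mul_prod_erase _ _ (Finset.mem_univ i), hσ, unilateral_self, combine_self]
    congr 1
    refine Finset.prod_congr rfl fun j hj => ?_
    rw [unilateral_of_ne (Finset.ne_of_mem_erase hj), betaStar, hlen']
  have hmu : ∀ xm (g : Fin (T - t) → ∀ j, A j),
      muMeas π σ h i xi xm (Fin.cons at_ g : Fin (T - t + 1) → ∀ j, A j) =
        βi h xi (at_ i) / marginal π i xi * (π (combine i xi xm) * G xm) *
          pathWeight σ (h ++ [at_]) (combine i xi xm) g := by
    intro xm g
    rw [muMeas, pathWeight_cons, hstep]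
    ring
  have hπ' : ∀ xm, piStar θ 1 Q (h ++ [at_]) (combine i xi xm) =
      θ t π i xi (at_ i) / like π (θ t π) at_ * (π (combine i xi xm) * G xm) := by
    intro xm
    rw [piStar_append_singleton, add_comm 1, hlen', ← hπ, bUpdate, if_pos hL,
      ← Finset.mul_prod_erase _ _ (Finset.mem_univ i), combine_self]
    ring
  have hmarg' : marginal (piStar θ 1 Q (h ++ [at_])) i xi =
      θ t π i xi (at_ i) / like π (θ t π) at_ * ∑ xm, π (combine i xi xm) * G xm := by
    simp only [marginal, hπ', Finset.mul_sum]
  simp only [hmu, ← Finset.mul_sum, sum_pathWeight σ hσsum, mul_one, condExp]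
  refine Finset.sum_congr rfl fun xm _ => Finset.sum_congr rfl fun g _ => ?_
  rw [muMeas, hmarg', hπ', mul_div_mul_left _ _ (div_pos hγ hL).ne', mul_assoc (_ / _),
    mul_div_mul_left _ _ (div_pos hβ hmarg).ne']
  ring
end
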